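/- arXiv:2506.12638 — 3 statements merged into one kernel-verified Lean document; each statement's English description precedes it below -/
import Mathlib

section
/- Every finite commutative ring A is a GE₂-ring; that is, SL₂(A) is generated by the elementary matrices E₁₂(a) and E₂₁(a) for a ∈ A. -/
/-- The elementary matrix `E₁₂(a)` with rows `(1, a)` and `(0, 1)`, as an element of `SL₂(A)`. -/
def E12 (A : Type*) [CommRing A] (a : A) : Matrix.SpecialLinearGroup (Fin 2) A :=
  ⟨!![1, a; 0, 1], by simp [Matrix.det_fin_two_of]⟩

/-- The elementary matrix `E₂₁(a)` with rows `(1, 0)` and `(a, 1)`, as an element of `SL₂(A)`. -/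
def E21 (A : Type*) [CommRing A] (a : A) : Matrix.SpecialLinearGroup (Fin 2) A :=
  ⟨!![1, 0; a, 1], by simp [Matrix.det_fin_two_of]⟩

/-- A coprime pair `(a, c)` in a finite commutative ring can be shortened: some `a + t * c` is a
unit. -/
theorem IsCoprime.exists_isUnit_add_mul_of_finite {A : Type*} [CommRing A] [Finite A] {a c : A}
    (h : IsCoprime a c) : ∃ t : A, IsUnit (a + t * c) := by
  obtain ⟨i, j, hij, hpow⟩ : ∃ i j : ℕ, i < j ∧ a ^ i = a ^ j := by
    obtain ⟨i, j, hne, heq⟩ := Finite.exists_ne_map_eq_of_infinite (fun n : ℕ => a ^ n)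
    rcases hne.lt_or_gt with hlt | hlt
    · exact ⟨i, j, hlt, heq⟩
    · exact ⟨j, i, hlt, heq.symm⟩
  have hzero : a ^ i * (1 - a ^ (j - i)) = 0 := by
    rw [mul_sub, mul_one, ← pow_add, Nat.add_sub_cancel' hij.le, hpow, sub_self]
  refine ⟨1 - a ^ (j - i), ?_⟩
  by_contra hu
  obtain ⟨m, hm, hum⟩ := exists_max_ideal_of_mem_nonunits hu
  have hmp := hm.isPrime
  by_cases ha : a ∈ m
  · have hpm : a ^ (j - i) ∈ m := m.pow_mem_of_mem ha _ (Nat.sub_pos_of_lt hij)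
    have hc : c ∈ m := by
      have hadd := m.add_mem (m.sub_mem hum ha) (m.mul_mem_right c hpm)
      ring_nf at hadd
      exact hadd
    obtain ⟨x, y, hxy⟩ := h
    exact hmp.ne_top ((Ideal.eq_top_iff_one m).2
      (hxy ▸ m.add_mem (m.mul_mem_left x ha) (m.mul_mem_left y hc)))
  · have hprod : a ^ i * (1 - a ^ (j - i)) ∈ m := hzero ▸ m.zero_mem
    have hsub : 1 - a ^ (j - i) ∈ m :=
      (hmp.mem_or_mem hprod).resolve_left fun hi => ha (hmp.mem_of_pow_mem i hi)
    exact ha ((m.add_mem_iff_left (m.mul_mem_right c hsub)).1 hum)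

/-- A matrix in `SL₂(A)` whose upper left entry is invertible is a product of elementary
matrices. -/
theorem eq_prod_E12_E21_of_mul_eq_one {A : Type*} [CommRing A]
    (M : Matrix.SpecialLinearGroup (Fin 2) A) {v : A} (hv : M 0 0 * v = 1) :
    M = E21 A (M 1 0 * v) * (E12 A (M 0 0) * E21 A (-v) * E12 A (M 0 0)) *
      (E12 A (-1) * E21 A 1 * E12 A (-1)) * E12 A (v * M 0 1) := by
  have hdet := Matrix.det_fin_two M.1 ▸ M.2
  change M 0 0 * M 1 1 - M 0 1 * M 1 0 = 1 at hdet
  ext i j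
  simp only [Matrix.SpecialLinearGroup.coe_mul]
  fin_cases i <;> fin_cases j <;>
    simp [E12, E21, Matrix.mul_apply, Fin.sum_univ_two] <;> grind

/-- every finite commutative ring is a `GE₂`-ring. -/
theorem finite_comm_ring_is_GE2
    (A : Type*) [CommRing A] [Finite A] :
    Subgroup.closure {M : Matrix.SpecialLinearGroup (Fin 2) A |
        ∃ a : A, M = E12 A a ∨ M = E21 A a} = ⊤ := by
  set H := Subgroup.closure {M : Matrix.SpecialLinearGroup (Fin 2) A |
    ∃ a : A, M = E12 A a ∨ M = E21 A a}
  have h12 (a : A) : E12 A a ∈ H := Subgroup.subset_closure ⟨a, .inl rfl⟩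
  have h21 (a : A) : E21 A a ∈ H := Subgroup.subset_closure ⟨a, .inr rfl⟩
  refine (Subgroup.eq_top_iff' H).2 fun M => ?_
  have hdet := Matrix.det_fin_two M.1 ▸ M.2
  change M 0 0 * M 1 1 - M 0 1 * M 1 0 = 1 at hdet
  have hcop : IsCoprime (M 0 0) (M 1 0) := ⟨M 1 1, -M 0 1, by linear_combination hdet⟩
  obtain ⟨t, ht⟩ := hcop.exists_isUnit_add_mul_of_finite
  have hentry : (E12 A t * M) 0 0 = M 0 0 + t * M 1 0 := by
    rw [Matrix.SpecialLinearGroup.coe_mul]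
    simp [E12, Matrix.mul_apply, Fin.sum_univ_two]
  rw [← hentry] at ht
  obtain ⟨v, hv⟩ := ht.exists_right_inv
  rw [← H.mul_mem_cancel_left (h12 t), eq_prod_E12_E21_of_mul_eq_one _ hv]
  have hw (a b c : A) : E12 A a * E21 A b * E12 A c ∈ H :=
    H.mul_mem (H.mul_mem (h12 a) (h21 b)) (h12 c)
  exact H.mul_mem (H.mul_mem (H.mul_mem (h21 _) (hw _ _ _)) (hw _ _ _)) (h12 _)
end

section
/- Let I be an ideal of a commutative ring A such that the quotient ring A/I is a GE₂-ring. Then the reduction map π_* : SL₂(A) → SL₂(A/I) is surjective, and its kernel is the principal congruence subgroup Γ(A, I) = { (a b; c d) ∈ SL₂(A) : b, c, a−1, d−1 ∈ I }; i.e., there is a short exact sequence 1 → Γ(A, I) → SL₂(A) → SL₂(A/I) → 1. -/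
/-- A commutative ring is a `GE₂`-ring if `SL₂` is generated by the elementary matrices. -/
def IsGE2Ring (A : Type*) [CommRing A] : Prop :=
  Subgroup.closure {M : Matrix.SpecialLinearGroup (Fin 2) A |
    ∃ a : A, M = E12 A a ∨ M = E21 A a} = ⊤

theorem map_E12 {A B : Type*} [CommRing A] [CommRing B] (f : A →+* B) (a : A) :
    Matrix.SpecialLinearGroup.map f (E12 A a) = E12 B (f a) := by
  ext i j
  rw [Matrix.SpecialLinearGroup.map_apply_coe]
  fin_cases i <;> fin_cases j <;> simp [E12]

theorem map_E21 {A B : Type*} [CommRing A] [CommRing B] (f : A →+* B) (a : A) :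
    Matrix.SpecialLinearGroup.map f (E21 A a) = E21 B (f a) := by
  ext i j
  rw [Matrix.SpecialLinearGroup.map_apply_coe]
  fin_cases i <;> fin_cases j <;> simp [E21]

/-- A surjective ring homomorphism onto a `GE₂`-ring induces a surjection on `SL₂`, since
elementary matrices lift. -/
theorem IsGE2Ring.map_surjective {A B : Type*} [CommRing A] [CommRing B] (hB : IsGE2Ring B)
    {f : A →+* B} (hf : Function.Surjective f) :
    Function.Surjective (Matrix.SpecialLinearGroup.map f :
      Matrix.SpecialLinearGroup (Fin 2) A →* Matrix.SpecialLinearGroup (Fin 2) B) := by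
  rw [← MonoidHom.range_eq_top, eq_top_iff, ← show _ = ⊤ from hB, Subgroup.closure_le]
  rintro _ ⟨b, rfl | rfl⟩
  all_goals obtain ⟨a, rfl⟩ := hf b
  · exact ⟨E12 A a, map_E12 f a⟩
  · exact ⟨E21 A a, map_E21 f a⟩

/-- if `A/I` is a `GE₂`-ring, then the entrywise reduction map
`SL₂(A) → SL₂(A/I)` is surjective with kernel the principal congruence subgroup
`Γ(A, I)`, yielding the short exact sequence `1 → Γ(A,I) → SL₂(A) → SL₂(A/I) → 1`. -/
theorem sl2_congruence_exact_sequence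
    (A : Type*) [CommRing A] (I : Ideal A) (hGE : IsGE2Ring (A ⧸ I)) :
    Function.Surjective (Matrix.SpecialLinearGroup.map (Ideal.Quotient.mk I) :
        Matrix.SpecialLinearGroup (Fin 2) A →* Matrix.SpecialLinearGroup (Fin 2) (A ⧸ I)) ∧
    ∀ M : Matrix.SpecialLinearGroup (Fin 2) A,
      M ∈ (Matrix.SpecialLinearGroup.map (Ideal.Quotient.mk I) :
          Matrix.SpecialLinearGroup (Fin 2) A →*
            Matrix.SpecialLinearGroup (Fin 2) (A ⧸ I)).ker ↔
        ((M : Matrix (Fin 2) (Fin 2) A) 0 1 ∈ I ∧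
         (M : Matrix (Fin 2) (Fin 2) A) 1 0 ∈ I ∧
         (M : Matrix (Fin 2) (Fin 2) A) 0 0 - 1 ∈ I ∧
         (M : Matrix (Fin 2) (Fin 2) A) 1 1 - 1 ∈ I) := by
  refine ⟨hGE.map_surjective Ideal.Quotient.mk_surjective, fun M ↦ ?_⟩
  simp only [← Ideal.Quotient.eq_zero_iff_mem, map_sub, map_one, sub_eq_zero]
  rw [MonoidHom.mem_ker, Matrix.SpecialLinearGroup.ext_iff]
  simp only [Fin.forall_fin_two, Matrix.SpecialLinearGroup.map_apply_coe,
    RingHom.mapMatrix_apply, Matrix.map_apply, Matrix.SpecialLinearGroup.coe_one,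
    Matrix.one_apply_eq, Matrix.one_apply_ne zero_ne_one, Matrix.one_apply_ne one_ne_zero]
  tauto
end

section
/- Let n > 1 be an integer and let ℤ[1/n] denote the localization of ℤ at the powers of n. Then SL₂(ℤ[1/n])^ab is isomorphic to: 0 if 2 | n and 3 | n; ℤ/3 if 2 | n and 3 ∤ n; ℤ/4 if 2 ∤ n and 3 | n; and ℤ/12 if 2 ∤ n and 3 ∤ n. -/
/-- The abelianization of `SL₂(R)`, written additively. -/
abbrev SL2ab (R : Type*) [CommRing R] : Type _ :=
  Additive (Abelianization (Matrix.SpecialLinearGroup (Fin 2) R))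

namespace SL2ab

open Matrix SpecialLinearGroup

section CommRing

variable {R : Type*} [CommRing R]

/-- The upper unitriangular matrix with off-diagonal entry `x`. -/
def upper (x : R) : SpecialLinearGroup (Fin 2) R :=
  ⟨!![1, x; 0, 1], by simp [det_fin_two_of]⟩

/-- The lower unitriangular matrix with off-diagonal entry `x`. -/
def lower (x : R) : SpecialLinearGroup (Fin 2) R :=
  ⟨!![1, 0; x, 1], by simp [det_fin_two_of]⟩

/-- The diagonal matrix with entries `u`, `u⁻¹`. -/
def diag (u : Rˣ) : SpecialLinearGroup (Fin 2) R :=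
  ⟨!![(u : R), 0; 0, ((u⁻¹ : Rˣ) : R)], by simp [det_fin_two_of]⟩

/-- The antidiagonal matrix with entries `u`, `-u⁻¹`. -/
def weyl (u : Rˣ) : SpecialLinearGroup (Fin 2) R :=
  ⟨!![0, (u : R); -((u⁻¹ : Rˣ) : R), 0], by simp [det_fin_two_of]⟩

@[simp] lemma coe_upper (x : R) : (upper x : Matrix (Fin 2) (Fin 2) R) = !![1, x; 0, 1] := rfl

@[simp] lemma coe_lower (x : R) : (lower x : Matrix (Fin 2) (Fin 2) R) = !![1, 0; x, 1] := rfl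

@[simp] lemma coe_diag (u : Rˣ) :
    (diag u : Matrix (Fin 2) (Fin 2) R) = !![(u : R), 0; 0, ((u⁻¹ : Rˣ) : R)] := rfl

@[simp] lemma coe_weyl (u : Rˣ) :
    (weyl u : Matrix (Fin 2) (Fin 2) R) = !![0, (u : R); -((u⁻¹ : Rˣ) : R), 0] := rfl

lemma upper_add (x y : R) : upper (x + y) = upper x * upper y := by
  ext i j
  fin_cases i <;> fin_cases j <;> simp [Matrix.mul_apply, Fin.sum_univ_two, add_comm]

lemma weyl_eq (u : Rˣ) :
    weyl u = upper (u : R) * lower (-((u⁻¹ : Rˣ) : R)) * upper (u : R) := by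
  ext i j
  fin_cases i <;> fin_cases j <;>
    simp [Matrix.mul_apply, Fin.sum_univ_two]

lemma diag_eq (u : Rˣ) : diag u = weyl u * weyl (-1) := by
  ext i j
  fin_cases i <;> fin_cases j <;> simp [Matrix.mul_apply, Fin.sum_univ_two]

lemma weyl_one_pow_four : (weyl (1 : Rˣ)) ^ 4 = 1 := by
  ext i j
  fin_cases i <;> fin_cases j <;>
    simp [pow_succ, Matrix.mul_apply, Fin.sum_univ_two]

lemma weyl_one_mul_upper (x : R) : weyl 1 * upper x = lower (-x) * weyl 1 := by
  ext i j
  fin_cases i <;> fin_cases j <;>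
    simp [Matrix.mul_apply, Fin.sum_univ_two]

lemma diag_mul_upper (u : Rˣ) (x : R) :
    diag u * upper x = upper ((u : R) ^ 2 * x) * diag u := by
  ext i j
  fin_cases i <;> fin_cases j <;>
    simp [Matrix.mul_apply, Fin.sum_univ_two]
  linear_combination (-(u : R) * x) * u.mul_inv

/-- The class of `upper x` in the abelianization of `SL₂(R)`. -/
def upperClass : R →+ SL2ab R :=
  AddMonoidHom.mk' (fun x => Additive.ofMul (Abelianization.of (upper x))) fun x y => by
    rw [upper_add, map_mul, ofMul_mul]

lemma ofMul_of_upper (x : R) :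
    Additive.ofMul (Abelianization.of (upper x)) = upperClass x := rfl

lemma ofMul_of_lower (x : R) :
    Additive.ofMul (Abelianization.of (lower x)) = upperClass (-x) := by
  have h := congrArg (fun g => Additive.ofMul (Abelianization.of g)) (weyl_one_mul_upper (-x))
  simp only [map_mul, ofMul_mul, neg_neg, ofMul_of_upper] at h
  rw [add_comm] at h
  exact (add_right_cancel h).symm

lemma upperClass_sq_mul (u : Rˣ) (x : R) :
    upperClass ((u : R) ^ 2 * x) = upperClass x := by
  have h := congrArg (fun g => Additive.ofMul (Abelianization.of g)) (diag_mul_upper u x)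
  simp only [map_mul, ofMul_mul, ofMul_of_upper] at h
  rw [add_comm] at h
  exact (add_right_cancel h).symm

lemma twelve_nsmul_upperClass_one : 12 • (upperClass (1 : R)) = 0 := by
  have h := congrArg (fun g => Additive.ofMul (Abelianization.of g)) (weyl_one_pow_four (R := R))
  simp only [weyl_eq, map_mul, map_pow, map_one, ofMul_mul, ofMul_pow, ofMul_one, ofMul_of_upper,
    ofMul_of_lower, Units.val_one, inv_one, neg_neg] at h
  rw [← h]
  abel

lemma sq_nsmul_upperClass_one (p : ℕ) (hp : IsUnit (p : R)) :
    (p ^ 2) • (upperClass (1 : R)) = upperClass 1 := by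
  obtain ⟨u, hu⟩ := hp
  rw [← map_nsmul]
  conv_rhs => rw [← upperClass_sq_mul u]
  simp [hu]

end CommRing

section Elementary

variable {R : Type*} [CommRing R] {H : Subgroup (SpecialLinearGroup (Fin 2) R)}

lemma weyl_mem (hU : ∀ x, upper x ∈ H) (hL : ∀ x, lower x ∈ H) (u : Rˣ) : weyl u ∈ H := by
  rw [weyl_eq]
  exact H.mul_mem (H.mul_mem (hU _) (hL _)) (hU _)

lemma mem_of_lower_left_eq_zero (hU : ∀ x, upper x ∈ H) (hL : ∀ x, lower x ∈ H)
    (g : SpecialLinearGroup (Fin 2) R) (hg : g 1 0 = 0) : g ∈ H := by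
  have hdet : g 0 0 * g 1 1 = 1 := by
    have h := g.det_coe
    rwa [det_fin_two, hg, mul_zero, sub_zero] at h
  let u : Rˣ := ⟨g 0 0, g 1 1, hdet, by rw [mul_comm, hdet]⟩
  have key : g = diag u * upper (g 1 1 * g 0 1) := by
    ext i j
    fin_cases i <;> fin_cases j
    · simp [u, Matrix.mul_apply, Fin.sum_univ_two]
    · simp [u, Matrix.mul_apply, Fin.sum_univ_two, ← mul_assoc, hdet]
    · simp [u, Matrix.mul_apply, Fin.sum_univ_two, hg]
    · simp [u, Matrix.mul_apply, Fin.sum_univ_two]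
  rw [key, diag_eq]
  exact H.mul_mem (H.mul_mem (weyl_mem hU hL _) (weyl_mem hU hL _)) (hU _)

/-- Euclid's algorithm: a matrix whose first column is integral up to a unit is a product of
elementary matrices. -/
lemma mem_of_first_column (hU : ∀ x, upper x ∈ H) (hL : ∀ x, lower x ∈ H) (u : Rˣ) (m : ℕ) :
    ∀ (p q : ℤ) (g : SpecialLinearGroup (Fin 2) R), q.natAbs = m →
      g 0 0 * u = p → g 1 0 * u = q → g ∈ H := by
  induction m using Nat.strong_induction_on with
  | _ m ih =>
    intro p q g hm hp hq
    rcases eq_or_ne q 0 with rfl | hq0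
    · exact mem_of_lower_left_eq_zero hU hL g (by simpa using hq)
    · have hlt : (-(p % q)).natAbs < m := by
        have h1 := Int.emod_nonneg p hq0
        have h2 := Int.emod_lt_abs p hq0
        rw [Int.abs_eq_natAbs] at h2
        omega
      have hpq : (p : R) = q * (p / q : ℤ) + (p % q : ℤ) := by
        rw [← Int.cast_mul, ← Int.cast_add, Int.mul_ediv_add_emod]
      have hmem : weyl 1 * (upper (-((p / q : ℤ) : R)) * g) ∈ H := by
        refine ih _ hlt q (-(p % q)) _ rfl ?_ ?_
        · simp [Matrix.vecMul, dotProduct, Fin.sum_univ_two, hq]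
        · simp [Matrix.vecMul, dotProduct, Fin.sum_univ_two]
          linear_combination ((p / q : ℤ) : R) * hq - hp - hpq
      exact (H.mul_mem_cancel_left (hU _)).1 ((H.mul_mem_cancel_left (weyl_mem hU hL 1)).1 hmem)

end Elementary

section Characters

/-- The character of `SL₂(ℤ/4)` sending `upper 1` to `1`, given by the multiplier system of the
square of the Dedekind eta function reduced modulo `4`. -/
def charFour : SpecialLinearGroup (Fin 2) (ZMod 4) →* Multiplicative (ZMod 4) :=
  MonoidHom.mk' (fun g => Multiplicative.ofAdd
    ((1 - g 1 0 ^ 2) * (g 0 1 * g 1 1 + 3 * (g 1 0 - 1) * g 1 1 + g 1 0 + 3) +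
      g 1 0 * (g 0 0 + g 1 1 - 3))) fun g h => by
    have key : ∀ a b c d : ZMod 4, a * d - b * c = 1 →
        ∀ a' b' c' d' : ZMod 4, a' * d' - b' * c' = 1 →
        let f := fun a b c d : ZMod 4 =>
          (1 - c ^ 2) * (b * d + 3 * (c - 1) * d + c + 3) + c * (a + d - 3)
        f (a * a' + b * c') (a * b' + b * d') (c * a' + d * c') (c * b' + d * d') =
          f a b c d + f a' b' c' d' := by
      decide +kernel
    have hg := g.det_coe
    have hh := h.det_coe
    rw [det_fin_two] at hg hh
    rw [← ofAdd_add]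
    refine congrArg Multiplicative.ofAdd ?_
    simpa [Matrix.mul_apply, Fin.sum_univ_two] using key _ _ _ _ hg _ _ _ _ hh

/-- The character of `SL₂(ℤ/3)` sending `upper 1` to `1`. -/
def charThree : SpecialLinearGroup (Fin 2) (ZMod 3) →* Multiplicative (ZMod 3) :=
  MonoidHom.mk' (fun g => Multiplicative.ofAdd
    ((1 - g 1 0 ^ 2) * (g 0 1 * g 1 1) + g 1 0 * (g 0 0 + g 1 1))) fun g h => by
    have key : ∀ a b c d : ZMod 3, a * d - b * c = 1 →
        ∀ a' b' c' d' : ZMod 3, a' * d' - b' * c' = 1 →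
        let f := fun a b c d : ZMod 3 => (1 - c ^ 2) * (b * d) + c * (a + d)
        f (a * a' + b * c') (a * b' + b * d') (c * a' + d * c') (c * b' + d * d') =
          f a b c d + f a' b' c' d' := by
      decide +kernel
    have hg := g.det_coe
    have hh := h.det_coe
    rw [det_fin_two] at hg hh
    rw [← ofAdd_add]
    refine congrArg Multiplicative.ofAdd ?_
    simpa [Matrix.mul_apply, Fin.sum_univ_two] using key _ _ _ _ hg _ _ _ _ hh

variable {R S : Type*} [CommRing R] [CommRing S]

/-- A character of `SL₂(S)` pulled back along a ring homomorphism `R →+* S`. -/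
def pullback {k : ℕ} (χ : SpecialLinearGroup (Fin 2) S →* Multiplicative (ZMod k))
    (f : R →+* S) : SL2ab R →+ ZMod k :=
  MonoidHom.toAdditiveLeft (Abelianization.lift (χ.comp (SpecialLinearGroup.map f)))

lemma pullback_upperClass {k : ℕ} (χ : SpecialLinearGroup (Fin 2) S →* Multiplicative (ZMod k))
    (f : R →+* S) (x : R) :
    pullback χ f (upperClass x) = (χ (upper (f x))).toAdd := by
  have h : SpecialLinearGroup.map f (upper x) = upper (f x) := by
    ext i j
    fin_cases i <;> fin_cases j <;> simp
  rw [← h]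
  rfl

lemma exists_hom_four (f : R →+* ZMod 4) :
    ∃ χ : SL2ab R →+ ZMod 4, χ (upperClass 1) = 1 := by
  refine ⟨pullback charFour f, ?_⟩
  rw [pullback_upperClass, map_one]
  decide +kernel

lemma exists_hom_three (f : R →+* ZMod 3) :
    ∃ χ : SL2ab R →+ ZMod 3, χ (upperClass 1) = 1 := by
  refine ⟨pullback charThree f, ?_⟩
  rw [pullback_upperClass, map_one]
  decide +kernel

end Characters

section Away

variable {n : ℕ}

lemma isUnit_natCast_of_dvd {p : ℕ} (h : p ∣ n) :
    IsUnit (p : Localization.Away (n : ℤ)) := by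
  have hn : IsUnit (n : Localization.Away (n : ℤ)) := by
    simpa using IsLocalization.Away.algebraMap_isUnit (S := Localization.Away (n : ℤ)) (n : ℤ)
  exact isUnit_of_dvd_unit (Nat.cast_dvd_cast h) hn

lemma exists_mul_pow_eq_intCast (x : Localization.Away (n : ℤ)) :
    ∃ (k : ℕ) (p : ℤ), x * (n : Localization.Away (n : ℤ)) ^ k = p := by
  obtain ⟨k, p, h⟩ := IsLocalization.Away.surj (n : ℤ) x
  exact ⟨k, p, by simpa using h⟩

lemma upperClass_mem_zmultiples (x : Localization.Away (n : ℤ)) :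
    upperClass x ∈ AddSubgroup.zmultiples (upperClass (1 : Localization.Away (n : ℤ))) := by
  obtain ⟨u, hu⟩ := isUnit_natCast_of_dvd (dvd_refl n)
  obtain ⟨k, p, hp⟩ := exists_mul_pow_eq_intCast x
  refine AddSubgroup.mem_zmultiples_iff.2 ⟨n ^ k * p, ?_⟩
  rw [← map_zsmul, ← upperClass_sq_mul (u ^ k) x]
  congr 1
  simp [hu, ← hp]
  ring

lemma mem_zmultiples (x : SL2ab (Localization.Away (n : ℤ))) :
    x ∈ AddSubgroup.zmultiples (upperClass (1 : Localization.Away (n : ℤ))) := by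
  let H : Subgroup (SpecialLinearGroup (Fin 2) (Localization.Away (n : ℤ))) :=
    (AddSubgroup.toSubgroup'
      (AddSubgroup.zmultiples (upperClass (1 : Localization.Away (n : ℤ))))).comap
      Abelianization.of
  have hU : ∀ x, upper x ∈ H := fun x => upperClass_mem_zmultiples x
  have hL : ∀ x, lower x ∈ H := fun x => by
    change Additive.ofMul (Abelianization.of (lower x)) ∈ AddSubgroup.zmultiples _
    rw [ofMul_of_lower]
    exact upperClass_mem_zmultiples (-x)
  obtain ⟨g, hg⟩ := QuotientGroup.mk_surjective (Additive.toMul x)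
  obtain ⟨u, hu⟩ := isUnit_natCast_of_dvd (dvd_refl n)
  obtain ⟨i, p, hp⟩ := exists_mul_pow_eq_intCast (g 0 0)
  obtain ⟨j, q, hq⟩ := exists_mul_pow_eq_intCast (g 1 0)
  have hgH : g ∈ H := by
    refine mem_of_first_column hU hL (u ^ (i + j)) _ (p * n ^ j) (q * n ^ i) g rfl ?_ ?_
    · simp [hu, ← hp]
      ring
    · simp [hu, ← hq]
      ring
  have hx : x = Additive.ofMul (Abelianization.of g) :=
    (congrArg Additive.ofMul hg).symm
  rw [hx]
  exact hgH

lemma nonempty_addEquiv {d : ℕ}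
    (χ : SL2ab (Localization.Away (n : ℤ)) →+ ZMod d) (hχ : χ (upperClass 1) = 1)
    (hd : d • upperClass (1 : Localization.Away (n : ℤ)) = 0) :
    Nonempty (SL2ab (Localization.Away (n : ℤ)) ≃+ ZMod d) := by
  refine ⟨AddEquiv.ofBijective χ ⟨?_, ?_⟩⟩
  · refine (injective_iff_map_eq_zero χ).2 fun x hx => ?_
    obtain ⟨k, rfl⟩ := AddSubgroup.mem_zmultiples_iff.1 (mem_zmultiples x)
    rw [map_zsmul, hχ, zsmul_one, ZMod.intCast_zmod_eq_zero_iff_dvd] at hx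
    obtain ⟨l, rfl⟩ := hx
    rw [mul_comm, mul_zsmul, natCast_zsmul, hd, zsmul_zero]
  · intro y
    obtain ⟨k, rfl⟩ := ZMod.intCast_surjective y
    exact ⟨k • upperClass 1, by rw [map_zsmul, hχ, zsmul_one]⟩

/-- Reduction modulo `m` on `ℤ[1/n]`, for `n` coprime to `m`. -/
noncomputable def reduction {m : ℕ} (h : n.Coprime m) :
    Localization.Away (n : ℤ) →+* ZMod m :=
  IsLocalization.Away.lift (g := Int.castRingHom (ZMod m)) (n : ℤ)
    (by simpa using (ZMod.isUnit_iff_coprime n m).2 h)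

lemma three_nsmul_upperClass_one (h : 2 ∣ n) :
    3 • upperClass (1 : Localization.Away (n : ℤ)) = 0 := by
  have h := sq_nsmul_upperClass_one 2 (isUnit_natCast_of_dvd h)
  rw [show 2 ^ 2 = 3 + 1 from rfl, succ_nsmul] at h
  simpa using h

lemma four_nsmul_upperClass_one (h : 3 ∣ n) :
    4 • upperClass (1 : Localization.Away (n : ℤ)) = 0 := by
  have h := sq_nsmul_upperClass_one 3 (isUnit_natCast_of_dvd h)
  rw [show 3 ^ 2 = 8 + 1 from rfl, succ_nsmul, add_eq_right] at h
  have h12 := twelve_nsmul_upperClass_one (R := Localization.Away (n : ℤ))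
  rwa [show 12 = 8 + 4 from rfl, add_nsmul, h, zero_add] at h12

end Away

end SL2ab

open SL2ab in
/-- the abelianization of `SL₂(ℤ[1/n])` for `n > 1`. -/
theorem sl2_abelianization_Z_one_over_n
    (n : ℕ) (hn : 1 < n) :
    (2 ∣ n → 3 ∣ n → Nonempty (SL2ab (Localization.Away (n : ℤ)) ≃+ ZMod 1)) ∧
    (2 ∣ n → ¬ 3 ∣ n → Nonempty (SL2ab (Localization.Away (n : ℤ)) ≃+ ZMod 3)) ∧
    (¬ 2 ∣ n → 3 ∣ n → Nonempty (SL2ab (Localization.Away (n : ℤ)) ≃+ ZMod 4)) ∧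
    (¬ 2 ∣ n → ¬ 3 ∣ n → Nonempty (SL2ab (Localization.Away (n : ℤ)) ≃+ ZMod 12)) := by
  have coprime_three (h : ¬ 3 ∣ n) : n.Coprime 3 :=
    ((Nat.Prime.coprime_iff_not_dvd Nat.prime_three).2 h).symm
  have coprime_four (h : ¬ 2 ∣ n) : n.Coprime 4 :=
    (((Nat.Prime.coprime_iff_not_dvd Nat.prime_two).2 h).symm).pow_right 2
  refine ⟨fun h2 h3 => ?_, fun h2 h3 => ?_, fun h2 h3 => ?_, fun h2 h3 => ?_⟩
  · refine nonempty_addEquiv 0 (Subsingleton.elim _ _) ?_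
    have h := four_nsmul_upperClass_one h3
    rwa [show 4 = 3 + 1 from rfl, add_nsmul, three_nsmul_upperClass_one h2, zero_add] at h
  · obtain ⟨χ, hχ⟩ := exists_hom_three (reduction (coprime_three h3))
    exact nonempty_addEquiv χ hχ (three_nsmul_upperClass_one h2)
  · obtain ⟨χ, hχ⟩ := exists_hom_four (reduction (coprime_four h2))
    exact nonempty_addEquiv χ hχ (four_nsmul_upperClass_one h3)
  · obtain ⟨χ, hχ⟩ := exists_hom_three (reduction (coprime_three h3))
    obtain ⟨ψ, hψ⟩ := exists_hom_four (reduction (coprime_four h2))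
    let e : ZMod 12 ≃+* ZMod 3 × ZMod 4 := ZMod.chineseRemainder (m := 3) (n := 4) (by norm_num)
    refine nonempty_addEquiv (e.symm.toAddEquiv.toAddMonoidHom.comp (χ.prod ψ)) ?_
      twelve_nsmul_upperClass_one
    have h : (χ.prod ψ) (upperClass 1) = 1 := Prod.ext hχ hψ
    rw [AddMonoidHom.comp_apply, h]
    exact map_one e.symm
end
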